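/- arXiv:2203.09273 — 2 statements merged into one kernel-verified Lean document; each statement's English description precedes it below -/
import Mathlib

section
/- For every integer k ≥ 2, every coprime integers 1 ≤ a ≤ q, and every ε > 0, the normalized Gauss sum G(a/q) = (1/q) ∑_{r=1}^{q} e^{2πi a r^k / q} satisfies |G(a/q)| ≤ C_ε · q^{ε - 1/(k(k-1))} for some constant C_ε depending only on ε (and k). -/
open Finset

noncomputable def e (x : ℝ) : ℂ := Complex.exp (2 * Real.pi * Complex.I * x)

noncomputable def warGauss (k q a : ℕ) : ℂ :=
  (q : ℂ)⁻¹ * ∑ r ∈ Finset.Icc 1 q, e ((a : ℝ) * (r : ℝ) ^ k / (q : ℝ))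

/-- The number of `k`-torsion points of a monoid. -/
noncomputable def torsionCount (k : ℕ) (G : Type) [Monoid G] : ℕ :=
  Nat.card {u : G // u ^ k = 1}

/-- The number of pairs with equal `k`-th powers. -/
noncomputable def powPairCount (k : ℕ) (R : Type) [Monoid R] : ℕ :=
  Nat.card {z : R × R // z.1 ^ k = z.2 ^ k}

lemma torsionCount_of_mulEquiv_prod (k : ℕ) {A B C : Type} [Monoid A] [Monoid B] [Monoid C]
    (f : A ≃* B × C) : torsionCount k A = torsionCount k B * torsionCount k C := by
  rw [torsionCount, torsionCount, torsionCount, ← Nat.card_prod]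
  refine Nat.card_congr ((f.toEquiv.subtypeEquiv fun a => ?_).trans Equiv.subtypeProdEquivProd)
  rw [← f.injective.eq_iff, map_pow, map_one, Prod.ext_iff]
  rfl

lemma powPairCount_of_mulEquiv_prod (k : ℕ) {A B C : Type} [Monoid A] [Monoid B] [Monoid C]
    (f : A ≃* B × C) : powPairCount k A = powPairCount k B * powPairCount k C := by
  rw [powPairCount, powPairCount, powPairCount, ← Nat.card_prod]
  refine Nat.card_congr ((((f.toEquiv.prodCongr f.toEquiv).trans
    (Equiv.prodProdProdComm B C B C)).subtypeEquiv fun a => ?_).trans Equiv.subtypeProdEquivProd)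
  rw [← f.injective.eq_iff, map_pow, map_pow, Prod.ext_iff]
  rfl

lemma torsionCount_units_mul (k : ℕ) {m n : ℕ} (h : m.Coprime n) :
    torsionCount k (ZMod (m * n))ˣ = torsionCount k (ZMod m)ˣ * torsionCount k (ZMod n)ˣ :=
  torsionCount_of_mulEquiv_prod k
    ((Units.mapEquiv (ZMod.chineseRemainder h).toMulEquiv).trans MulEquiv.prodUnits)

lemma powPairCount_mul (k : ℕ) {m n : ℕ} (h : m.Coprime n) :
    powPairCount k (ZMod (m * n)) = powPairCount k (ZMod m) * powPairCount k (ZMod n) :=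
  powPairCount_of_mulEquiv_prod k (ZMod.chineseRemainder h).toMulEquiv

lemma torsionCount_le_of_isCyclic (k : ℕ) (hk : 0 < k) (G : Type) [Group G] [Finite G]
    [IsCyclic G] : torsionCount k G ≤ k := by
  classical
  have := Fintype.ofFinite G
  rw [torsionCount, Nat.card_eq_fintype_card, Fintype.card_subtype]
  exact IsCyclic.card_pow_eq_one_le hk

lemma torsionCount_le_index_mul (k : ℕ) (hk : 0 < k) (G : Type) [CommGroup G] [Finite G]
    (H : Subgroup G) [IsCyclic H] : torsionCount k G ≤ H.index * k := by
  have hker : torsionCount k G = Nat.card (powMonoidHom k : G →* G).ker := rfl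
  set K := (powMonoidHom k : G →* G).ker with hK
  have hle : Nat.card (H.subgroupOf K) ≤ k := by
    refine le_trans ?_ (torsionCount_le_of_isCyclic k hk H)
    refine Nat.card_le_card_of_injective
      (fun x => (⟨⟨x.1.1, x.2⟩, Subtype.ext x.1.2⟩ : {u : H // u ^ k = 1})) fun x y h => ?_
    exact Subtype.ext (Subtype.ext (congrArg (fun z => (z.1.1 : G)) h))
  rw [hker, ← Subgroup.card_mul_index (H.subgroupOf K), mul_comm]
  refine Nat.mul_le_mul ?_ hle
  exact Nat.le_of_dvd (Nat.pos_of_ne_zero H.index_ne_zero_of_finite)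
    (Subgroup.relIndex_dvd_index_of_normal H K)

lemma torsionCount_units_two_pow_le (k : ℕ) (hk : 0 < k) (n : ℕ) :
    torsionCount k (ZMod (2 ^ n))ˣ ≤ 2 * k := by
  obtain hn | hn := le_or_gt n 2
  · have : IsCyclic (ZMod (2 ^ n))ˣ := (ZMod.isCyclic_units_two_pow_iff n).2 hn
    exact (torsionCount_le_of_isCyclic k hk _).trans (by omega)
  · obtain ⟨m, rfl⟩ := Nat.exists_eq_add_of_le' hn.le
    let g : (ZMod (2 ^ (m + 2)))ˣ := ZMod.unitOfCoprime 5 (Nat.Coprime.pow_right _ (by norm_num))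
    have hg : orderOf g = 2 ^ m := by
      rw [← orderOf_units, ZMod.coe_unitOfCoprime]
      exact_mod_cast ZMod.orderOf_five m
    have hcard := Subgroup.card_mul_index (Subgroup.zpowers g)
    rw [Nat.card_zpowers, hg, Nat.card_eq_fintype_card, ZMod.card_units_eq_totient,
      Nat.totient_prime_pow_succ Nat.prime_two] at hcard
    have hi : (Subgroup.zpowers g).index = 2 :=
      Nat.eq_of_mul_eq_mul_left (pow_pos two_pos m) (by rw [hcard, pow_succ]; simp)
    calc torsionCount k (ZMod (2 ^ (m + 2)))ˣ ≤ (Subgroup.zpowers g).index * k :=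
          torsionCount_le_index_mul k hk _ _
      _ = 2 * k := by rw [hi]

lemma torsionCount_units_prime_pow_le (k : ℕ) (hk : 0 < k) {p : ℕ} (hp : p.Prime) (n : ℕ) :
    torsionCount k (ZMod (p ^ n))ˣ ≤ 2 * k := by
  obtain rfl | h2 := eq_or_ne p 2
  · exact torsionCount_units_two_pow_le k hk n
  · have := ZMod.isCyclic_units_of_prime_pow p hp h2 n
    have : NeZero (p ^ n) := ⟨pow_ne_zero _ hp.ne_zero⟩
    exact (torsionCount_le_of_isCyclic k hk _).trans (by omega)

/-- Removing a common factor `p` from the non-unit pairs reduces the modulus by `p ^ k`. -/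
lemma powPairCount_prime_pow_le (k : ℕ) (hk : 0 < k) {p : ℕ} (hp : p.Prime) {m : ℕ}
    (hm : 0 < m) :
    powPairCount k (ZMod (p ^ m)) ≤ p ^ m * torsionCount k (ZMod (p ^ m))ˣ +
      powPairCount k (ZMod (p ^ (m - k))) * (p ^ (m - 1 - (m - k)) * p ^ (m - 1 - (m - k))) := by
  have : NeZero (p ^ m) := ⟨pow_ne_zero _ hp.ne_zero⟩
  have hq0 : 0 < p ^ (m - k) := pow_pos hp.pos _
  have : NeZero (p ^ (m - k)) := ⟨hq0.ne'⟩
  set c := p ^ (m - 1 - (m - k)) with hc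
  have hqc : p ^ (m - k) * c * p = p ^ m := by
    rw [hc, ← pow_add, ← pow_succ]
    congr 1
    omega
  have hunit : ∀ x : ZMod (p ^ m), ¬ IsUnit x → p ∣ x.val := fun x hx => by
    by_contra h
    refine hx ?_
    rw [← ZMod.natCast_zmod_val x, ZMod.isUnit_iff_coprime]
    exact (Nat.Coprime.pow_left _ ((Nat.Prime.coprime_iff_not_dvd hp).2 h)).symm
  classical
  let Z := {z : ZMod (p ^ m) × ZMod (p ^ m) // z.1 ^ k = z.2 ^ k}
  have hiff : ∀ z : Z, IsUnit z.1.1 ↔ IsUnit z.1.2 := fun z => by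
    rw [← isUnit_pow_iff hk.ne', z.2, isUnit_pow_iff hk.ne']
  have hsplit : Nat.card Z =
      Nat.card {z : Z // IsUnit z.1.1} + Nat.card {z : Z // ¬ IsUnit z.1.1} := by
    rw [← Nat.card_sum]
    exact (Nat.card_congr (Equiv.sumCompl _)).symm
  change Nat.card Z ≤ _
  rw [hsplit]
  refine add_le_add ?_ ?_
  · let f : {z : Z // IsUnit z.1.1} → ZMod (p ^ m) × {u : (ZMod (p ^ m))ˣ // u ^ k = 1} := fun z =>
      ⟨z.1.1.1, ((hiff z.1).1 z.2).unit / z.2.unit, by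
        rw [div_pow, div_eq_one]
        ext
        simpa using z.1.2.symm⟩
    have hf : Function.Injective f := fun z w h => by
      have h1 : z.1.1.1 = w.1.1.1 := congrArg (fun t => t.1) h
      have h2 : ((hiff z.1).1 z.2).unit / z.2.unit = ((hiff w.1).1 w.2).unit / w.2.unit :=
        congrArg (fun t => (t.2 : (ZMod (p ^ m))ˣ)) h
      have h3 : z.2.unit = w.2.unit := Units.ext h1
      rw [h3, div_left_inj] at h2
      exact Subtype.ext (Subtype.ext (Prod.ext h1 (congrArg Units.val h2)))
    have := Nat.card_le_card_of_injective f hf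
    rwa [Nat.card_prod, Nat.card_zmod] at this
  · have hdiv : ∀ x : ZMod (p ^ m), x.val / p / p ^ (m - k) < c := fun x => by
      rw [Nat.div_div_eq_div_mul, Nat.div_lt_iff_lt_mul (Nat.mul_pos hp.pos hq0)]
      calc x.val < p ^ m := ZMod.val_lt x
        _ = c * (p * p ^ (m - k)) := by rw [← hqc]; ring
    have hpow : ∀ z : {z : Z // ¬ IsUnit z.1.1},
        ((z.1.1.1.val / p : ℕ) : ZMod (p ^ (m - k))) ^ k =
          ((z.1.1.2.val / p : ℕ) : ZMod (p ^ (m - k))) ^ k := fun z => by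
      obtain ⟨x, hx⟩ := hunit _ z.2
      obtain ⟨y, hy⟩ := hunit _ ((hiff z.1).not.1 z.2)
      have h := z.1.2
      rw [← ZMod.natCast_zmod_val z.1.1.1, ← ZMod.natCast_zmod_val z.1.1.2, hx, hy] at h
      rw [hx, hy, Nat.mul_div_cancel_left _ hp.pos, Nat.mul_div_cancel_left _ hp.pos]
      norm_cast at h ⊢
      rw [ZMod.natCast_eq_natCast_iff, mul_pow, mul_pow] at h
      rw [ZMod.natCast_eq_natCast_iff]
      obtain hmk | hmk := le_total m k
      · rw [Nat.sub_eq_zero_of_le hmk, pow_zero]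
        exact Nat.modEq_one
      · rw [← Nat.add_sub_cancel' hmk, pow_add] at h
        exact Nat.ModEq.mul_left_cancel' (pow_ne_zero _ hp.ne_zero) h
    let f : {z : Z // ¬ IsUnit z.1.1} →
        {z : ZMod (p ^ (m - k)) × ZMod (p ^ (m - k)) // z.1 ^ k = z.2 ^ k} × (Fin c × Fin c) :=
      fun z => ⟨⟨((z.1.1.1.val / p : ℕ), (z.1.1.2.val / p : ℕ)), hpow z⟩,
        ⟨_, hdiv z.1.1.1⟩, ⟨_, hdiv z.1.1.2⟩⟩
    have hrec : ∀ x y : ZMod (p ^ m), ¬ IsUnit x → ¬ IsUnit y →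
        ((x.val / p : ℕ) : ZMod (p ^ (m - k))) = (y.val / p : ℕ) →
        x.val / p / p ^ (m - k) = y.val / p / p ^ (m - k) → x = y := fun x y hx hy h1 h2 => by
      rw [ZMod.natCast_eq_natCast_iff'] at h1
      have h3 : x.val / p = y.val / p := by
        rw [← Nat.div_add_mod (x.val / p) (p ^ (m - k)), h1, h2, Nat.div_add_mod]
      exact ZMod.val_injective _ ((Nat.div_left_inj (hunit x hx) (hunit y hy)).1 h3)
    have hf : Function.Injective f := fun z w h => by
      have hz := (hiff z.1).not.1 z.2
      have hw := (hiff w.1).not.1 w.2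
      simp only [f, Prod.mk.injEq, Subtype.mk.injEq, Fin.mk.injEq] at h
      exact Subtype.ext (Subtype.ext (Prod.ext (hrec _ _ z.2 w.2 h.1.1 h.2.1)
        (hrec _ _ hz hw h.1.2 h.2.2)))
    have := Nat.card_le_card_of_injective f hf
    rwa [Nat.card_prod, Nat.card_prod, Nat.card_fin] at this

lemma powPairCount_prime_pow_le_rpow (k : ℕ) (hk : 2 ≤ k) {p : ℕ} (hp : p.Prime) (m : ℕ) :
    (powPairCount k (ZMod (p ^ m)) : ℝ) ≤
      2 * k * (m + 1) * (p : ℝ) ^ (2 * m - 2 * m / k : ℝ) := by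
  have hk' : (2 : ℝ) ≤ k := by exact_mod_cast hk
  have hk0 : (0 : ℝ) < k := by linarith
  have hp1 : (1 : ℝ) ≤ p := by exact_mod_cast hp.one_le
  have hp0 : (0 : ℝ) < p := by linarith
  induction m using Nat.strong_induction_on with
  | _ m ih =>
  obtain rfl | hm := Nat.eq_zero_or_pos m
  · have : powPairCount k (ZMod (p ^ 0)) = 1 := by
      rw [pow_zero]
      have : Subsingleton (ZMod 1) := inferInstanceAs (Subsingleton (Fin 1))
      have : Nonempty {z : ZMod 1 × ZMod 1 // z.1 ^ k = z.2 ^ k} := ⟨⟨(1, 1), rfl⟩⟩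
      exact Nat.card_of_subsingleton this.some
    rw [this]
    norm_num
    linarith
  have hm' : (1 : ℝ) ≤ m := by exact_mod_cast hm
  have hfirst : ((p ^ m * torsionCount k (ZMod (p ^ m))ˣ : ℕ) : ℝ) ≤
      2 * k * (p : ℝ) ^ (2 * m - 2 * m / k : ℝ) := by
    have ht : (torsionCount k (ZMod (p ^ m))ˣ : ℝ) ≤ 2 * k := by
      exact_mod_cast torsionCount_units_prime_pow_le k (by omega) hp m
    have hpm : (p : ℝ) ^ m ≤ (p : ℝ) ^ (2 * m - 2 * m / k : ℝ) := by
      rw [← Real.rpow_natCast]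
      refine Real.rpow_le_rpow_of_exponent_le hp1 ?_
      have : (2 * m / k : ℝ) ≤ m := by
        rw [div_le_iff₀ hk0]
        nlinarith
      linarith
    push_cast
    rw [mul_comm]
    gcongr
  have hsecond : ((powPairCount k (ZMod (p ^ (m - k))) *
      (p ^ (m - 1 - (m - k)) * p ^ (m - 1 - (m - k))) : ℕ) : ℝ) ≤
        2 * k * m * (p : ℝ) ^ (2 * m - 2 * m / k : ℝ) := by
    have hI := ih (m - k) (by omega)
    have hexp : (2 * (m - k : ℕ) - 2 * (m - k : ℕ) / k : ℝ) +
        ((m - 1 - (m - k) : ℕ) + (m - 1 - (m - k) : ℕ) : ℝ) ≤ 2 * m - 2 * m / k := by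
      obtain hmk | hmk := le_total m k
      · rw [Nat.sub_eq_zero_of_le hmk, Nat.sub_zero, Nat.cast_sub hm]
        have : (2 * m / k : ℝ) ≤ 2 := by
          rw [div_le_iff₀ hk0]
          have : (m : ℝ) ≤ k := by exact_mod_cast hmk
          linarith
        norm_num
        linarith
      · have h1 : m - 1 - (m - k) = k - 1 := by omega
        rw [h1, Nat.cast_sub hmk, Nat.cast_sub (by omega : 1 ≤ k)]
        apply le_of_eq
        field_simp
        push_cast
        ring
    have hcoef : (2 * k * ((m - k : ℕ) + 1) : ℝ) ≤ 2 * k * m := by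
      have : ((m - k : ℕ) + 1 : ℝ) ≤ m := by
        exact_mod_cast (by omega : m - k + 1 ≤ m)
      gcongr
    push_cast
    calc _ ≤ (2 * k * ((m - k : ℕ) + 1) * (p : ℝ) ^ (2 * (m - k : ℕ) - 2 * (m - k : ℕ) / k : ℝ)) *
          ((p : ℝ) ^ (m - 1 - (m - k)) * (p : ℝ) ^ (m - 1 - (m - k))) := by gcongr
      _ = 2 * k * ((m - k : ℕ) + 1) * (p : ℝ) ^ ((2 * (m - k : ℕ) - 2 * (m - k : ℕ) / k : ℝ) +
          ((m - 1 - (m - k) : ℕ) + (m - 1 - (m - k) : ℕ) : ℝ)) := by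
        rw [Real.rpow_add hp0, Real.rpow_add hp0, Real.rpow_natCast, mul_assoc]
      _ ≤ _ := by gcongr
  have h : (powPairCount k (ZMod (p ^ m)) : ℝ) ≤ _ :=
    Nat.cast_le.2 (powPairCount_prime_pow_le k (by omega) hp hm)
  rw [Nat.cast_add] at h
  refine (h.trans (add_le_add hfirst hsecond)).trans (le_of_eq ?_)
  ring

/-- A submultiplicative function growing at most linearly in the exponent on prime powers is
bounded by every positive power. -/
lemma exists_le_mul_rpow_of_prime_pow_le (f : ℕ → ℝ) (h0 : ∀ n, 0 ≤ f n) (h1 : f 1 ≤ 1)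
    (hmul : ∀ m n : ℕ, 0 < m → 0 < n → m.Coprime n → f (m * n) ≤ f m * f n) (B : ℝ) (hB : 1 ≤ B)
    (hpp : ∀ p m : ℕ, p.Prime → 0 < m → f (p ^ m) ≤ B * (m + 1)) (δ : ℝ) (hδ : 0 < δ) :
    ∃ C : ℝ, 0 < C ∧ ∀ n : ℕ, 0 < n → f n ≤ C * (n : ℝ) ^ δ := by
  set D : ℝ := B * (1 / (δ * Real.log 2) + 1) with hD
  have hlog : 0 < δ * Real.log 2 := mul_pos hδ (Real.log_pos one_lt_two)
  have hD1 : 1 ≤ D := by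
    have : 0 < 1 / (δ * Real.log 2) := by positivity
    nlinarith
  obtain ⟨P, hP⟩ := exists_nat_ge ((2 * B) ^ (1 / δ))
  have hsmall : ∀ p m : ℕ, p.Prime → B * (m + 1) ≤ D * ((p ^ m : ℕ) : ℝ) ^ δ := fun p m hp => by
    have h2 : ((2 : ℝ) ^ m) ^ δ ≤ ((p ^ m : ℕ) : ℝ) ^ δ := by
      push_cast
      have : (2 : ℝ) ≤ p := by exact_mod_cast hp.two_le
      gcongr
    have h3 : ((2 : ℝ) ^ m) ^ δ = Real.exp (m * (δ * Real.log 2)) := by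
      rw [Real.rpow_def_of_pos (by positivity), Real.log_pow]
      ring_nf
    have h4 := Real.add_one_le_exp (m * (δ * Real.log 2))
    have h5 : (0 : ℝ) ≤ m * (δ * Real.log 2) := by positivity
    have h6 : (m + 1 : ℝ) ≤ (1 / (δ * Real.log 2) + 1) * ((2 : ℝ) ^ m) ^ δ := by
      have h7 : (m : ℝ) ≤ 1 / (δ * Real.log 2) * ((2 : ℝ) ^ m) ^ δ := by
        rw [one_div, ← div_eq_inv_mul, le_div_iff₀ hlog]
        linarith
      linarith
    calc B * (m + 1) ≤ B * ((1 / (δ * Real.log 2) + 1) * ((2 : ℝ) ^ m) ^ δ) := by gcongr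
      _ = D * ((2 : ℝ) ^ m) ^ δ := by rw [hD]; ring
      _ ≤ _ := by gcongr
  have hlarge : ∀ p m : ℕ, 0 < m → P ≤ p → B * (m + 1) ≤ ((p ^ m : ℕ) : ℝ) ^ δ :=
      fun p m hm hp => by
    have hp2 : 2 * B ≤ (p : ℝ) ^ δ := by
      have : (2 * B) ^ (1 / δ) ≤ (p : ℝ) := hP.trans (by exact_mod_cast hp)
      calc 2 * B = ((2 * B) ^ (1 / δ)) ^ δ := by
            rw [← Real.rpow_mul (by positivity), one_div_mul_cancel hδ.ne', Real.rpow_one]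
        _ ≤ _ := by gcongr
    have hm2 : (m + 1 : ℝ) ≤ 2 ^ m := by exact_mod_cast Nat.succ_le_of_lt m.lt_two_pow_self
    calc B * (m + 1) ≤ B ^ m * 2 ^ m := by
          gcongr
          exact le_self_pow₀ hB hm.ne'
      _ = (2 * B) ^ m := by rw [mul_pow, mul_comm]
      _ ≤ ((p : ℝ) ^ δ) ^ m := by gcongr
      _ = _ := by
        push_cast
        rw [← Real.rpow_natCast, ← Real.rpow_natCast, ← Real.rpow_mul (by positivity),
          ← Real.rpow_mul (by positivity), mul_comm]
  have key : ∀ n : ℕ, 0 < n → f n ≤ D ^ #{p ∈ n.primeFactors | p < P} * (n : ℝ) ^ δ := by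
    intro n
    induction n using Nat.recOnPosPrimePosCoprime with
    | zero => intro h; exact absurd h (lt_irrefl 0)
    | one => simpa using h1
    | prime_pow p m hp hm =>
      intro _
      refine (hpp p m hp hm).trans ?_
      rw [Nat.primeFactors_prime_pow hm.ne' hp, Finset.filter_singleton]
      split_ifs with h
      · simpa using hsmall p m hp
      · simpa using hlarge p m hm (not_lt.1 h)
    | coprime a b ha hb hab iha ihb =>
      intro _
      have ha0 : 0 < a := by omega
      have hb0 : 0 < b := by omega
      rw [hab.primeFactors_mul, Finset.filter_union, Finset.card_union_of_disjoint
        (Finset.disjoint_filter_filter hab.disjoint_primeFactors), pow_add, Nat.cast_mul,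
        Real.mul_rpow (by positivity) (by positivity)]
      calc f (a * b) ≤ f a * f b := hmul a b ha0 hb0 hab
        _ ≤ _ := mul_le_mul (iha ha0) (ihb hb0) (h0 b) (by positivity)
        _ = _ := by ring
  refine ⟨D ^ P, by positivity, fun n hn => (key n hn).trans ?_⟩
  gcongr
  refine (Finset.card_le_card fun p hp => ?_).trans (Finset.card_range P).le
  exact Finset.mem_range.2 (Finset.mem_filter.1 hp).2

/-- The complete exponential sum of `b * x ^ k` over `ZMod q`. -/
noncomputable def powExpSum (k q : ℕ) [NeZero q] (b : ZMod q) : ℂ :=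
  ∑ x : ZMod q, ZMod.stdAddChar (b * x ^ k)

lemma warGauss_eq_powExpSum (k q a : ℕ) [NeZero q] :
    warGauss k q a = (q : ℂ)⁻¹ * powExpSum k q a := by
  rw [warGauss, powExpSum]
  congr 1
  have hterm : ∀ r : ℕ, e ((a : ℝ) * (r : ℝ) ^ k / (q : ℝ)) =
      ZMod.stdAddChar ((a : ZMod q) * (r : ZMod q) ^ k) := fun r => by
    have := ZMod.stdAddChar_coe (N := q) ((a * r ^ k : ℕ) : ℤ)
    push_cast at this
    rw [this, e]
    push_cast
    ring_nf
  simp_rw [hterm]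
  refine Finset.sum_nbij (fun r : ℕ => (r : ZMod q)) (fun _ _ => Finset.mem_univ _) ?_ ?_
    fun _ _ => rfl
  · intro x hx y hy hxy
    simp only [Finset.coe_Icc, Set.mem_Icc] at hx hy
    have h := (ZMod.natCast_eq_natCast_iff x y q).1 hxy
    obtain hle | hle := le_total x y
    · have := Nat.eq_zero_of_dvd_of_lt ((Nat.modEq_iff_dvd' hle).1 h) (by omega)
      omega
    · have := Nat.eq_zero_of_dvd_of_lt ((Nat.modEq_iff_dvd' hle).1 h.symm) (by omega)
      omega
  · intro x _
    have hq := NeZero.pos q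
    obtain hx | hx := Nat.eq_zero_or_pos x.val
    · exact ⟨q, by simp; omega, by simp [(ZMod.val_eq_zero x).1 hx]⟩
    · exact ⟨x.val, by simpa using ⟨hx, (ZMod.val_lt x).le⟩, ZMod.natCast_zmod_val x⟩

lemma powExpSum_mul_pow_units (k q : ℕ) [NeZero q] (b : ZMod q) (u : (ZMod q)ˣ) :
    powExpSum k q (b * (u : ZMod q) ^ k) = powExpSum k q b := by
  refine Fintype.sum_equiv u.mulLeft _ _ fun x => ?_
  rw [Units.mulLeft_apply, mul_pow, mul_assoc]

lemma sum_norm_powExpSum_sq (k q : ℕ) [NeZero q] :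
    ∑ b : ZMod q, ‖powExpSum k q b‖ ^ 2 = q * powPairCount k (ZMod q) := by
  classical
  have hcount : powPairCount k (ZMod q) = #{z : ZMod q × ZMod q | z.1 ^ k = z.2 ^ k} := by
    rw [powPairCount, Nat.card_eq_fintype_card, Fintype.card_subtype]
  have hsq : ∀ b : ZMod q, ((‖powExpSum k q b‖ ^ 2 : ℝ) : ℂ) =
      ∑ z : ZMod q × ZMod q, ZMod.stdAddChar (b * (z.1 ^ k - z.2 ^ k)) := fun b => by
    rw [Complex.ofReal_pow, ← Complex.mul_conj', powExpSum, map_sum, Finset.sum_mul_sum,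
      Fintype.sum_prod_type]
    refine Finset.sum_congr rfl fun x _ => Finset.sum_congr rfl fun y _ => ?_
    rw [← AddChar.map_neg_eq_conj, ← AddChar.map_add_eq_mul]
    ring_nf
  apply Complex.ofReal_injective
  rw [Complex.ofReal_sum]
  simp_rw [hsq]
  rw [Finset.sum_comm]
  simp_rw [AddChar.sum_mulShift _ (ZMod.isPrimitive_stdAddChar q), sub_eq_zero, ZMod.card]
  rw [hcount]
  push_cast
  rw [← Finset.sum_filter, Finset.sum_const, nsmul_eq_mul, mul_comm]

lemma card_filter_mul_pow_le_torsionCount (k q : ℕ) [NeZero q] (a : (ZMod q)ˣ) (b : ZMod q) :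
    #{u : (ZMod q)ˣ | (a : ZMod q) * (u : ZMod q) ^ k = b} ≤ torsionCount k (ZMod q)ˣ := by
  obtain h | ⟨v, hv⟩ :=
    (Finset.univ.filter fun u : (ZMod q)ˣ =>
      (a : ZMod q) * (u : ZMod q) ^ k = b).eq_empty_or_nonempty
  · rw [h]
    exact Nat.zero_le _
  rw [torsionCount, Nat.card_eq_fintype_card, Fintype.card_subtype]
  refine Finset.card_le_card_of_injOn (fun u => u / v) (fun u hu => ?_)
    fun x _ y _ h => div_left_injective h
  rw [Finset.mem_coe, Finset.mem_filter] at hu ⊢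
  refine ⟨Finset.mem_univ _, ?_⟩
  rw [div_pow, div_eq_one]
  have h := hu.2.trans (Finset.mem_filter.1 hv).2.symm
  rw [a.isUnit.mul_right_inj] at h
  exact Units.ext (by simpa using h)

lemma totient_mul_norm_powExpSum_sq_le (k q : ℕ) [NeZero q] (a : (ZMod q)ˣ) :
    (q.totient : ℝ) * ‖powExpSum k q a‖ ^ 2 ≤
      torsionCount k (ZMod q)ˣ * (q * powPairCount k (ZMod q)) := by
  calc (q.totient : ℝ) * ‖powExpSum k q a‖ ^ 2
      = ∑ u : (ZMod q)ˣ, ‖powExpSum k q (a * (u : ZMod q) ^ k)‖ ^ 2 := by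
        simp_rw [powExpSum_mul_pow_units]
        rw [Finset.sum_const, Finset.card_univ, ZMod.card_units_eq_totient, nsmul_eq_mul]
    _ = ∑ b : ZMod q, ∑ u ∈ Finset.univ.filter
            (fun u : (ZMod q)ˣ => (a : ZMod q) * (u : ZMod q) ^ k = b),
          ‖powExpSum k q (a * (u : ZMod q) ^ k)‖ ^ 2 :=
        (Finset.sum_fiberwise _ (fun u : (ZMod q)ˣ => (a : ZMod q) * (u : ZMod q) ^ k) _).symm
    _ ≤ ∑ b : ZMod q, torsionCount k (ZMod q)ˣ * ‖powExpSum k q b‖ ^ 2 := by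
        refine Finset.sum_le_sum fun b _ => ?_
        have hconst : ∀ u ∈ Finset.univ.filter
            (fun u : (ZMod q)ˣ => (a : ZMod q) * (u : ZMod q) ^ k = b),
            ‖powExpSum k q (a * (u : ZMod q) ^ k)‖ ^ 2 = ‖powExpSum k q b‖ ^ 2 :=
          fun u hu => by rw [(Finset.mem_filter.1 hu).2]
        rw [Finset.sum_congr rfl hconst, Finset.sum_const, nsmul_eq_mul]
        gcongr
        exact card_filter_mul_pow_le_torsionCount k q a b
    _ = _ := by rw [← Finset.mul_sum, sum_norm_powExpSum_sq]

lemma norm_warGauss_sq_le (k q a : ℕ) (hq : 0 < q) (ha : a.Coprime q) :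
    ‖warGauss k q a‖ ^ 2 ≤
      torsionCount k (ZMod q)ˣ * powPairCount k (ZMod q) / (q * q.totient) := by
  have : NeZero q := ⟨hq.ne'⟩
  have hφ : (0 : ℝ) < q.totient := by exact_mod_cast Nat.totient_pos.2 hq
  have hq' : (0 : ℝ) < q := by exact_mod_cast hq
  have h := totient_mul_norm_powExpSum_sq_le k q (ZMod.unitOfCoprime a ha)
  rw [ZMod.coe_unitOfCoprime] at h
  rw [warGauss_eq_powExpSum, norm_mul, norm_inv, Complex.norm_natCast, mul_pow, le_div_iff₀
    (by positivity)]
  calc ((q : ℝ)⁻¹) ^ 2 * ‖powExpSum k q a‖ ^ 2 * (q * q.totient)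
      = (q : ℝ)⁻¹ * (q.totient * ‖powExpSum k q a‖ ^ 2) := by field_simp
    _ ≤ (q : ℝ)⁻¹ * (torsionCount k (ZMod q)ˣ * (q * powPairCount k (ZMod q))) := by gcongr
    _ = _ := by field_simp

lemma exists_count_ratio_le (k : ℕ) (hk : 2 ≤ k) (δ : ℝ) (hδ : 0 < δ) :
    ∃ C : ℝ, 0 < C ∧ ∀ q : ℕ, 0 < q →
      (torsionCount k (ZMod q)ˣ * powPairCount k (ZMod q) / (q * q.totient) : ℝ) ≤
        C * (q : ℝ) ^ (δ - 2 / k : ℝ) := by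
  have hk' : (2 : ℝ) ≤ k := by exact_mod_cast hk
  let f : ℕ → ℝ := fun q =>
    (torsionCount k (ZMod q)ˣ * powPairCount k (ZMod q) / (q * q.totient) : ℝ) *
      (q : ℝ) ^ (2 / k : ℝ)
  have hone : f 1 ≤ 1 := by
    have h1 : torsionCount k (ZMod 1)ˣ ≤ 1 := by
      have : Subsingleton (ZMod 1) := inferInstanceAs (Subsingleton (Fin 1))
      exact Finite.card_le_one_iff_subsingleton.2 inferInstance
    have h2 : powPairCount k (ZMod 1) ≤ 1 := by
      have : Subsingleton (ZMod 1) := inferInstanceAs (Subsingleton (Fin 1))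
      exact Finite.card_le_one_iff_subsingleton.2 inferInstance
    have h3 : ((torsionCount k (ZMod 1)ˣ * powPairCount k (ZMod 1) : ℕ) : ℝ) ≤ 1 := by
      exact_mod_cast Nat.mul_le_mul h1 h2
    simpa [f] using h3
  have hmul : ∀ m n : ℕ, 0 < m → 0 < n → m.Coprime n → f (m * n) ≤ f m * f n :=
    fun m n _ _ hmn => by
      refine le_of_eq ?_
      simp only [f, torsionCount_units_mul k hmn, powPairCount_mul k hmn, Nat.totient_mul hmn]
      push_cast
      rw [Real.mul_rpow (by positivity) (by positivity)]
      ring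
  have hpp : ∀ p m : ℕ, p.Prime → 0 < m → f (p ^ m) ≤ 8 * k ^ 2 * (m + 1) := fun p m hp hm => by
    have hp0 : (0 : ℝ) < p := by exact_mod_cast hp.pos
    have ht : (torsionCount k (ZMod (p ^ m))ˣ : ℝ) ≤ 2 * k := by
      exact_mod_cast torsionCount_units_prime_pow_le k (by omega) hp m
    have hM := powPairCount_prime_pow_le_rpow k hk hp m
    have hφ : (p : ℝ) ^ m ≤ 2 * ((p ^ m).totient : ℝ) := by
      obtain ⟨n, rfl⟩ := Nat.exists_eq_add_of_le' hm
      rw [Nat.totient_prime_pow_succ hp]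
      have h2 : p ≤ 2 * (p - 1) := by have := hp.two_le; omega
      exact_mod_cast (by rw [pow_succ]; nlinarith [pow_pos hp.pos n] :
        p ^ (n + 1) ≤ 2 * (p ^ n * (p - 1)))
    have hφ0 : (0 : ℝ) < ((p ^ m).totient : ℝ) := by
      exact_mod_cast Nat.totient_pos.2 (pow_pos hp.pos m)
    have hpow : (p : ℝ) ^ (2 * m - 2 * m / k : ℝ) * ((p : ℝ) ^ m) ^ (2 / k : ℝ) =
        (p : ℝ) ^ m * (p : ℝ) ^ m := by
      rw [← Real.rpow_natCast, ← Real.rpow_mul hp0.le, ← Real.rpow_add hp0, ← Real.rpow_add hp0]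
      congr 1
      ring
    simp only [f]
    push_cast
    rw [div_mul_eq_mul_div, div_le_iff₀ (by positivity)]
    calc _ ≤ 2 * k * (2 * k * (m + 1) * (p : ℝ) ^ (2 * m - 2 * m / k : ℝ)) *
          ((p : ℝ) ^ m) ^ (2 / k : ℝ) := by gcongr
      _ = 4 * k ^ 2 * (m + 1) * ((p : ℝ) ^ m * (p : ℝ) ^ m) := by rw [← hpow]; ring
      _ ≤ 4 * k ^ 2 * (m + 1) * ((p : ℝ) ^ m * (2 * ((p ^ m).totient : ℝ))) := by gcongr
      _ = _ := by ring
  obtain ⟨C, hC, h⟩ := exists_le_mul_rpow_of_prime_pow_le f (fun n => by positivity) hone hmul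
    (8 * k ^ 2) (by nlinarith) hpp δ hδ
  refine ⟨C, hC, fun q hq => ?_⟩
  have hq' : (0 : ℝ) < q := by exact_mod_cast hq
  rw [Real.rpow_sub hq', ← mul_div_assoc, le_div_iff₀ (by positivity)]
  exact h q hq

theorem gauss_sum_bound (k : ℕ) (hk : 2 ≤ k) (ε : ℝ) (hε : 0 < ε) :
    ∃ C : ℝ, 0 < C ∧ ∀ a q : ℕ, 1 ≤ a → a ≤ q → Nat.Coprime a q →
      ‖warGauss k q a‖ ≤ C * (q : ℝ) ^ (ε - 1 / (k * (k - 1)) : ℝ) := by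
  obtain ⟨C, hC, h⟩ := exists_count_ratio_le k hk (2 * ε) (by positivity)
  refine ⟨√C, Real.sqrt_pos.2 hC, fun a q ha haq hcop => ?_⟩
  have hq : 0 < q := by omega
  have hq1 : (1 : ℝ) ≤ q := by exact_mod_cast hq
  have hk' : (2 : ℝ) ≤ k := by exact_mod_cast hk
  have hexp : (1 / (k * (k - 1)) : ℝ) ≤ 1 / k :=
    one_div_le_one_div_of_le (by positivity) (by nlinarith)
  calc ‖warGauss k q a‖ ≤ √C * (q : ℝ) ^ (ε - 1 / k : ℝ) := by
        refine (sq_le_sq₀ (norm_nonneg _) (by positivity)).1 ?_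
        rw [mul_pow, Real.sq_sqrt hC.le, ← Real.rpow_natCast, ← Real.rpow_natCast,
          ← Real.rpow_mul (by positivity)]
        refine le_trans ?_ ((h q hq).trans (le_of_eq ?_))
        · exact_mod_cast norm_warGauss_sq_le k q a hq hcop
        · congr 2
          push_cast
          ring
    _ ≤ _ := by gcongr
end

section
/- Suppose g : [A, B] → ℝ is twice differentiable on [A,B] with 0 ≤ g'(x) ≤ 1/2 and g''(x) ≥ 0 for all x ∈ [A,B]. Then ∑_{A ≤ n ≤ B, n ∈ ℤ} e^{2πi g(n)} = ∫_A^B e^{2πi g(x)} dx + O(1), where the implied constant is absolute. -/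
open Real Set

lemma norm_e (x : ℝ) : ‖e x‖ = 1 := by
  have : e x = Complex.exp ((2 * π * x : ℝ) * Complex.I) := by
    unfold e; congr 1; push_cast; ring
  rw [this, Complex.norm_exp_ofReal_mul_I]

lemma continuous_e : Continuous e := by
  unfold e; fun_prop

lemma hasDerivAt_e (x : ℝ) : HasDerivAt e (2 * π * Complex.I * e x) x := by
  have h : HasDerivAt (fun y : ℝ => 2 * π * Complex.I * (y : ℂ)) (2 * π * Complex.I) x := by
    simpa using (Complex.ofRealCLM.hasDerivAt (x := x)).const_mul (2 * π * Complex.I)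
  exact h.cexp.congr_deriv (mul_comm _ _)

lemma norm_e_sub_e_le (x y : ℝ) : ‖e x - e y‖ ≤ 2 * π * |x - y| := by
  have h := Convex.norm_image_sub_le_of_norm_hasDerivWithin_le (f := e) (C := 2 * π) (s := univ)
    (fun z _ => (hasDerivAt_e z).hasDerivWithinAt)
    (fun z _ => by simp [norm_e, abs_of_pos pi_pos]) convex_univ (mem_univ y) (mem_univ x)
  simpa using h

/-- The function `cot (π θ) - 1 / (π θ)`; division by zero gives it its limit value at `θ = 0`. -/
noncomputable def cotRemainder (θ : ℝ) : ℝ := cos (π * θ) / sin (π * θ) - 1 / (π * θ)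

lemma cotRemainder_zero : cotRemainder 0 = 0 := by simp [cotRemainder]

lemma cotRemainder_nonpos {θ : ℝ} (h0 : 0 ≤ θ) (h1 : θ ≤ 1 / 2) : cotRemainder θ ≤ 0 := by
  rcases h0.eq_or_lt with rfl | h0
  · simp [cotRemainder]
  have hx : 0 < π * θ := by positivity
  have hx2 : π * θ ≤ π / 2 := by nlinarith [pi_pos]
  have hs : 0 < sin (π * θ) := sin_pos_of_pos_of_lt_pi hx (by linarith [pi_pos])
  rw [cotRemainder, sub_nonpos, div_le_div_iff₀ hs hx, one_mul]
  rcases hx2.eq_or_lt with h | h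
  · rw [h]; simp
  · have ht := lt_tan hx h
    rw [tan_eq_sin_div_cos, lt_div_iff₀ (cos_pos_of_mem_Ioo ⟨by linarith, h⟩)] at ht
    linarith

lemma hasDerivAt_cotRemainder {θ : ℝ} (hθ : θ ≠ 0) (hs : sin (π * θ) ≠ 0) :
    HasDerivAt cotRemainder (π * (1 / (π * θ) ^ 2 - 1 / sin (π * θ) ^ 2)) θ := by
  have hm : HasDerivAt (fun y : ℝ => π * y) π θ := by
    simpa using (hasDerivAt_id θ).const_mul π
  have hne : π * θ ≠ 0 := mul_ne_zero pi_ne_zero hθ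
  have h := (hm.cos.div hm.sin hs).sub ((hasDerivAt_const θ (1 : ℝ)).div hm hne)
  refine h.congr_deriv ?_
  have := sin_sq_add_cos_sq (π * θ)
  have hc : cos (π * θ) ^ 2 = 1 - sin (π * θ) ^ 2 := by linarith
  field_simp
  rw [hc]
  ring

lemma antitoneOn_cotRemainder : AntitoneOn cotRemainder (Icc 0 (1 / 2)) := by
  have hsin {θ : ℝ} (hθ : θ ∈ Ioc (0 : ℝ) (1 / 2)) : 0 < sin (π * θ) :=
    sin_pos_of_pos_of_lt_pi (mul_pos pi_pos hθ.1) (by nlinarith [pi_pos, hθ.2])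
  have hd {θ : ℝ} (hθ : θ ∈ Ioc (0 : ℝ) (1 / 2)) :=
    hasDerivAt_cotRemainder hθ.1.ne' (hsin hθ).ne'
  have hanti : AntitoneOn cotRemainder (Ioc 0 (1 / 2)) := by
    refine antitoneOn_of_deriv_nonpos (convex_Ioc _ _)
      (fun θ hθ => (hd hθ).continuousAt.continuousWithinAt)
      (fun θ hθ => (hd (interior_subset hθ)).differentiableAt.differentiableWithinAt)
      (fun θ hθ => ?_)
    replace hθ := interior_subset hθ
    rw [(hd hθ).deriv]
    refine mul_nonpos_of_nonneg_of_nonpos pi_pos.le (sub_nonpos.2 ?_)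
    have := hsin hθ
    have := (sin_lt (mul_pos pi_pos hθ.1)).le
    gcongr
  intro x hx y hy hxy
  rcases hx.1.eq_or_lt with rfl | h0
  · rw [cotRemainder_zero]; exact cotRemainder_nonpos hy.1 hy.2
  · exact hanti ⟨h0, hx.2⟩ ⟨h0.trans_le hxy, hy.2⟩ hxy

lemma neg_one_le_cotRemainder {θ : ℝ} (h0 : 0 ≤ θ) (h1 : θ ≤ 1 / 2) : -1 ≤ cotRemainder θ := by
  refine le_trans ?_ (antitoneOn_cotRemainder ⟨h0, h1⟩ (right_mem_Icc.2 (by norm_num)) h1)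
  have h : π * (1 / 2) = π / 2 := by ring
  rw [cotRemainder, h, cos_pi_div_two, zero_div, zero_sub, neg_le_neg_iff,
    div_le_one (by positivity)]
  linarith [pi_gt_three]

lemma e_add (x y : ℝ) : e (x + y) = e x * e y := by
  simp only [e, ← Complex.exp_add]; congr 1; push_cast; ring

lemma integral_e_linear (a : ℝ) {θ : ℝ} (hθ : θ ≠ 0) :
    ∫ t in (0 : ℝ)..1, e (a + θ * t) = (e (a + θ) - e a) / (2 * π * Complex.I * θ) := by
  have hne : (2 * π * Complex.I * θ : ℂ) ≠ 0 := by
    simp [pi_ne_zero, hθ]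
  have hd (t : ℝ) : HasDerivAt (fun t : ℝ => e (a + θ * t) / (2 * π * Complex.I * θ))
      (e (a + θ * t)) t := by
    have hl : HasDerivAt (fun t : ℝ => a + θ * t) θ t := by
      simpa using ((hasDerivAt_id t).const_mul θ).const_add a
    refine (((hasDerivAt_e _).scomp t hl).div_const _).congr_deriv ?_
    rw [Complex.real_smul, div_eq_iff hne]; ring
  rw [intervalIntegral.integral_eq_sub_of_hasDerivAt (fun t _ => hd t)
    (Continuous.intervalIntegrable (continuous_e.comp (by fun_prop)) _ _)]
  simp [sub_div]

lemma e_sub_integral_e_linear (a : ℝ) {θ : ℝ} (h0 : 0 ≤ θ) (h1 : θ ≤ 1 / 2) :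
    e a - ∫ t in (0 : ℝ)..1, e (a + θ * t) =
      -(1 / 2) * (e (a + θ) - e a)
        - Complex.I / 2 * (cotRemainder θ * (e (a + θ) - e a)) := by
  rcases h0.eq_or_lt with rfl | h0
  · simp
  have hs : (sin (π * θ) : ℂ) ≠ 0 := by
    exact_mod_cast (sin_pos_of_pos_of_lt_pi (mul_pos pi_pos h0) (by nlinarith [pi_pos])).ne'
  have hπ : (π : ℂ) ≠ 0 := by exact_mod_cast pi_ne_zero
  have hθ : (θ : ℂ) ≠ 0 := by exact_mod_cast h0.ne'
  have he : e θ = (cos (π * θ) + sin (π * θ) * Complex.I) ^ 2 := by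
    have := Complex.exp_mul_I ((π * θ : ℝ) : ℂ)
    rw [← Complex.ofReal_cos, ← Complex.ofReal_sin] at this
    rw [← this, ← Complex.exp_nat_mul, e]
    congr 1; push_cast; ring
  have hsc : (sin (π * θ) : ℂ) ^ 2 + (cos (π * θ) : ℂ) ^ 2 = 1 := by
    exact_mod_cast sin_sq_add_cos_sq (π * θ)
  rw [integral_e_linear a h0.ne', e_add, he, cotRemainder]
  push_cast at hs hsc ⊢
  generalize Complex.sin (π * θ) = s at *
  generalize Complex.cos (π * θ) = c at *
  have hc : c ^ 2 = 1 - s ^ 2 := by linear_combination hsc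
  have hz : (c + s * Complex.I) ^ 2 - 1 = 2 * s * Complex.I * (c + s * Complex.I) := by
    linear_combination hc - s ^ 2 * Complex.I_sq
  have hw : (c + s * Complex.I) * (c - s * Complex.I) = 1 := by
    linear_combination hc - s ^ 2 * Complex.I_sq
  have hI : Complex.I ≠ 0 := Complex.I_ne_zero
  have hz' : e a * (c + s * Complex.I) ^ 2 - e a =
      e a * (2 * s * Complex.I * (c + s * Complex.I)) := by
    rw [← hz]; ring
  have hcot : (c / s - 1 / (π * θ)) * (e a * (2 * s * Complex.I * (c + s * Complex.I))) =
      2 * Complex.I * e a * (c + s * Complex.I) * (c - s / (π * θ)) := by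
    field_simp
  have hint : e a * (2 * s * Complex.I * (c + s * Complex.I)) / (2 * π * Complex.I * θ) =
      e a * (c + s * Complex.I) * (s / (π * θ)) := by
    field_simp
  rw [hz', hcot, hint]
  linear_combination (-e a) * hw +
    e a * (c + s * Complex.I) * (c - s / (π * θ)) * Complex.I_sq

/-- Summation by parts with a monotone bounded weight. -/
lemma norm_sum_antitone_mul_sub_le {a : ℕ → ℝ} {u : ℕ → ℂ} (hu : ∀ n, ‖u n‖ ≤ 1) {N : ℕ}
    (ha : ∀ n, n + 1 < N → a (n + 1) ≤ a n)
    (h0 : ∀ n < N, a n ≤ 0) (h1 : ∀ n < N, -1 ≤ a n) :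
    ‖∑ n ∈ Finset.range N, (a n : ℂ) * (u (n + 1) - u n)‖ ≤ 2 := by
  have hmul (r : ℝ) (n : ℕ) : ‖(r : ℂ) * u n‖ ≤ |r| := by
    rw [norm_mul, Complex.norm_real, Real.norm_eq_abs]
    exact mul_le_of_le_one_right (abs_nonneg _) (hu n)
  have key (M : ℕ) (hM : M < N) :
      ‖∑ n ∈ Finset.range (M + 1), (a n : ℂ) * (u (n + 1) - u n) - a M * u (M + 1)‖ ≤ -a M := by
    induction M with
    | zero =>
      have h := hmul (-a 0) 0
      rw [abs_of_nonneg (by linarith [h0 0 hM])] at h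
      refine le_of_eq_of_le (congrArg _ ?_) h
      simp; ring
    | succ M ih =>
      have h := hmul (a M - a (M + 1)) (M + 1)
      rw [abs_of_nonneg (by linarith [ha M hM])] at h
      have heq : ∑ n ∈ Finset.range (M + 1 + 1), (a n : ℂ) * (u (n + 1) - u n)
          - a (M + 1) * u (M + 1 + 1) =
          (∑ n ∈ Finset.range (M + 1), (a n : ℂ) * (u (n + 1) - u n) - a M * u (M + 1))
            + ((a M - a (M + 1) : ℝ) : ℂ) * u (M + 1) := by
        rw [Finset.sum_range_succ _ (M + 1)]; push_cast; ring
      rw [heq]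
      linarith [norm_add_le_of_le (ih (by omega)) h]
  cases N with
  | zero => simp
  | succ M =>
    have h := hmul (a M) (M + 1)
    rw [abs_of_nonpos (h0 M (by omega))] at h
    have := norm_add_le_of_le (key M (by omega)) h
    rw [sub_add_cancel] at this
    linarith [h1 M (by omega)]

lemma exists_slope_eq {g g' : ℝ → ℝ} {c t : ℝ} (ht : 0 ≤ t)
    (hg : ∀ x ∈ Icc c (c + t), HasDerivAt g (g' x) x) :
    ∃ ξ ∈ Icc c (c + t), g (c + t) = g c + g' ξ * t := by
  rcases ht.eq_or_lt with rfl | ht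
  · exact ⟨c, by simp, by simp⟩
  obtain ⟨ξ, hξ, h⟩ := exists_hasDerivAt_eq_slope g g' (show c < c + t by linarith)
    (fun x hx => (hg x hx).continuousAt.continuousWithinAt)
    (fun x hx => hg x (Ioo_subset_Icc_self hx))
  refine ⟨ξ, Ioo_subset_Icc_self hξ, ?_⟩
  rw [h, add_sub_cancel_left, div_mul_cancel₀ _ ht.ne']; ring

/-- On a unit interval the phase may be replaced by its chord. -/
lemma norm_integral_chord_sub_integral_le {g g' : ℝ → ℝ} {c : ℝ}
    (hg : ∀ x ∈ Icc c (c + 1), HasDerivAt g (g' x) x) (hmono : MonotoneOn g' (Icc c (c + 1))) :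
    ‖(∫ t in (0 : ℝ)..1, e (g c + (g (c + 1) - g c) * t)) - ∫ x in c..(c + 1), e (g x)‖ ≤
      2 * π * (g' (c + 1) - g' c) := by
  have hcl : c ∈ Icc c (c + 1) := left_mem_Icc.2 (by linarith)
  have hcr : c + 1 ∈ Icc c (c + 1) := right_mem_Icc.2 (by linarith)
  have hshift : ∫ x in c..(c + 1), e (g x) = ∫ t in (0 : ℝ)..1, e (g (c + t)) := by
    rw [intervalIntegral.integral_comp_add_left (fun x => e (g x)), add_zero]
  have hcont : ContinuousOn (fun t => e (g (c + t))) (uIcc 0 1) := by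
    rw [uIcc_of_le zero_le_one]
    refine continuous_e.comp_continuousOn fun t ht => ?_
    exact (ContinuousAt.comp (f := fun t => c + t)
      (hg (c + t) ⟨by linarith [ht.1], by linarith [ht.2]⟩).continuousAt
      (by fun_prop)).continuousWithinAt
  have hchord : Continuous fun t => e (g c + (g (c + 1) - g c) * t) :=
    continuous_e.comp (by fun_prop)
  rw [hshift, ← intervalIntegral.integral_sub (hchord.intervalIntegrable _ _)
    hcont.intervalIntegrable]
  have hbound : ∀ t ∈ uIoc (0 : ℝ) 1,
      ‖e (g c + (g (c + 1) - g c) * t) - e (g (c + t))‖ ≤ 2 * π * (g' (c + 1) - g' c) := by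
    intro t ht
    rw [uIoc_of_le zero_le_one] at ht
    refine (norm_e_sub_e_le _ _).trans ?_
    have hsub : Icc c (c + t) ⊆ Icc c (c + 1) := Icc_subset_Icc_right (by linarith [ht.2])
    obtain ⟨ξ, hξ, hξe⟩ := exists_slope_eq ht.1.le (fun x hx => hg x (hsub hx))
    obtain ⟨η, hη, hηe⟩ := exists_slope_eq zero_le_one hg
    replace hξ := hsub hξ
    have heq : g c + (g (c + 1) - g c) * t - g (c + t) = (g' η - g' ξ) * t := by
      rw [hξe, hηe]; ring
    rw [heq, abs_mul, abs_of_pos ht.1]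
    have hle : |g' η - g' ξ| ≤ g' (c + 1) - g' c := by
      have h1 := hmono hcl hξ hξ.1
      have h2 := hmono hcl hη hη.1
      have h3 := hmono hξ hcr hξ.2
      have h4 := hmono hη hcr hη.2
      rw [abs_le]; constructor <;> linarith
    have := mul_le_of_le_one_right (abs_nonneg (g' η - g' ξ)) ht.2
    exact mul_le_mul_of_nonneg_left (by linarith) (by positivity)
  simpa using intervalIntegral.norm_integral_le_of_norm_le_const hbound

lemma norm_sum_e_sub_integral_le {g g' : ℝ → ℝ} {a : ℝ} {N : ℕ}
    (hg : ∀ x ∈ Icc a (a + N), HasDerivAt g (g' x) x) (hmono : MonotoneOn g' (Icc a (a + N)))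
    (h0 : ∀ x ∈ Icc a (a + N), 0 ≤ g' x) (h1 : ∀ x ∈ Icc a (a + N), g' x ≤ 1 / 2) :
    ‖(∑ n ∈ Finset.range N, e (g (a + n))) - ∫ x in a..(a + N), e (g x)‖ ≤ 2 + π := by
  have hmem {n : ℕ} (hn : n ≤ N) : a + n ∈ Icc a (a + N) :=
    ⟨by simp, by simpa using hn⟩
  have hsub {n : ℕ} (hn : n < N) : Icc (a + n) (a + n + 1) ⊆ Icc a (a + N) := by
    have h : ((n + 1 : ℕ) : ℝ) ≤ N := by exact_mod_cast hn
    push_cast at h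
    exact Icc_subset_Icc (by simp) (by linarith)
  set θ : ℕ → ℝ := fun n => g (a + n + 1) - g (a + n) with hθ
  have hslope {n : ℕ} (hn : n < N) : ∃ ξ ∈ Icc (a + n) (a + n + 1), θ n = g' ξ := by
    obtain ⟨ξ, hξ, h⟩ := exists_slope_eq zero_le_one (fun x hx => hg x (hsub hn hx))
    exact ⟨ξ, hξ, by rw [hθ]; dsimp only; rw [h]; ring⟩
  have hθmem {n : ℕ} (hn : n < N) : θ n ∈ Icc (0 : ℝ) (1 / 2) := by
    obtain ⟨ξ, hξ, h⟩ := hslope hn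
    exact h ▸ ⟨h0 ξ (hsub hn hξ), h1 ξ (hsub hn hξ)⟩
  have hθmono {n : ℕ} (hn : n + 1 < N) : θ n ≤ θ (n + 1) := by
    obtain ⟨ξ, hξ, h⟩ := hslope (n := n) (by omega)
    obtain ⟨η, hη, h'⟩ := hslope hn
    rw [h, h']
    refine hmono (hsub (by omega) hξ) (hsub hn hη) (hξ.2.trans ?_)
    have := hη.1
    push_cast at this
    linarith
  set u : ℕ → ℂ := fun n => e (g (a + n)) with hu
  have husucc (n : ℕ) : u (n + 1) = e (g (a + n + 1)) := by
    simp only [hu]; push_cast; rw [add_assoc]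
  have hint : ∫ x in a..(a + N), e (g x) =
      ∑ n ∈ Finset.range N, ∫ x in (a + n)..(a + n + 1), e (g x) := by
    have h := intervalIntegral.sum_integral_adjacent_intervals (f := fun x => e (g x))
      (μ := MeasureTheory.volume) (a := fun n : ℕ => a + n) (n := N) fun k hk => by
        refine ContinuousOn.intervalIntegrable ?_
        refine continuous_e.comp_continuousOn fun x hx => ?_
        rw [uIcc_of_le (by simp)] at hx
        push_cast at hx
        rw [← add_assoc] at hx
        exact (hg x (hsub hk hx)).continuousAt.continuousWithinAt
    simp only [Nat.cast_zero, add_zero, Nat.cast_add, Nat.cast_one, ← add_assoc] at h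
    exact h.symm
  have hterm : ∀ n ∈ Finset.range N, u n - ∫ x in (a + n)..(a + n + 1), e (g x) =
      -(1 / 2) * (u (n + 1) - u n)
        - Complex.I / 2 * (cotRemainder (θ n) * (u (n + 1) - u n))
        + ((∫ t in (0 : ℝ)..1, e (g (a + n) + θ n * t))
          - ∫ x in (a + n)..(a + n + 1), e (g x)) := by
    intro n hn
    have hn := hθmem (Finset.mem_range.1 hn)
    have h := e_sub_integral_e_linear (g (a + n)) hn.1 hn.2
    rw [show g (a + n) + θ n = g (a + n + 1) by simp [hθ], ← husucc] at h
    rw [← h]; ring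
  rw [hint, ← Finset.sum_sub_distrib, Finset.sum_congr rfl hterm, Finset.sum_add_distrib,
    Finset.sum_sub_distrib, ← Finset.mul_sum, ← Finset.mul_sum, Finset.sum_range_sub]
  have hnorm (n : ℕ) : ‖u n‖ ≤ 1 := (norm_e _).le
  have hends : ‖-(1 / 2 : ℂ) * (u N - u 0)‖ ≤ 1 := by
    have := norm_sub_le_of_le (hnorm N) (hnorm 0)
    rw [norm_mul]; norm_num; linarith
  have hparts : ‖Complex.I / 2 *
      ∑ n ∈ Finset.range N, (cotRemainder (θ n) : ℂ) * (u (n + 1) - u n)‖ ≤ 1 := by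
    have := norm_sum_antitone_mul_sub_le (a := fun n => cotRemainder (θ n)) hnorm (N := N)
      (fun n hn => antitoneOn_cotRemainder (hθmem (by omega)) (hθmem hn) (hθmono hn))
      (fun n hn => cotRemainder_nonpos (hθmem hn).1 (hθmem hn).2)
      (fun n hn => neg_one_le_cotRemainder (hθmem hn).1 (hθmem hn).2)
    rw [norm_mul]; norm_num; linarith
  have hchord : ‖∑ n ∈ Finset.range N, ((∫ t in (0 : ℝ)..1, e (g (a + n) + θ n * t))
      - ∫ x in (a + n)..(a + n + 1), e (g x))‖ ≤ π := by
    have hle : ∀ n ∈ Finset.range N, ‖(∫ t in (0 : ℝ)..1, e (g (a + n) + θ n * t))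
        - ∫ x in (a + n)..(a + n + 1), e (g x)‖ ≤
        2 * π * (g' (a + (n + 1 : ℕ)) - g' (a + n)) := by
      intro n hn
      have hn := hsub (Finset.mem_range.1 hn)
      have := norm_integral_chord_sub_integral_le (fun x hx => hg x (hn hx)) (hmono.mono hn)
      rwa [Nat.cast_add_one, ← add_assoc]
    refine (norm_sum_le_of_le _ hle).trans ?_
    rw [← Finset.mul_sum, Finset.sum_range_sub (fun n : ℕ => g' (a + n))]
    have := h1 _ (hmem le_rfl)
    have := h0 _ (hmem (Nat.zero_le N))
    nlinarith [pi_pos]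
  linarith [norm_add_le_of_le (norm_sub_le_of_le hends hparts) hchord]

/-- van der Corput's lemma: the exponential sum is approximated by the
exponential integral with an absolute constant error. -/
theorem van_der_corput :
    ∃ C : ℝ, 0 < C ∧ ∀ (A B : ℝ) (g g' g'' : ℝ → ℝ), A ≤ B →
      (∀ x ∈ Set.Icc A B, HasDerivAt g (g' x) x) →
      (∀ x ∈ Set.Icc A B, HasDerivAt g' (g'' x) x) →
      (∀ x ∈ Set.Icc A B, 0 ≤ g' x ∧ g' x ≤ 1 / 2) →
      (∀ x ∈ Set.Icc A B, 0 ≤ g'' x) →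
      ‖(∑ n ∈ Finset.Icc ⌈A⌉ ⌊B⌋, e (g n)) - ∫ x in A..B, e (g x)‖ ≤ C := by
  refine ⟨5 + π, by positivity, fun A B g g' g'' hAB hg hg' hbd hconv => ?_⟩
  have htriv (x y : ℝ) : ‖∫ t in x..y, e (g t)‖ ≤ |y - x| := by
    simpa using intervalIntegral.norm_integral_le_of_norm_le_const
      (a := x) (b := y) (C := 1) fun t _ => (norm_e (g t)).le
  have hA := Int.le_ceil A
  have hA' := Int.ceil_lt_add_one A
  have hB := Int.floor_le B
  have hB' := Int.lt_floor_add_one B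
  rcases lt_or_ge ⌊B⌋ ⌈A⌉ with hlt | hle
  · have h1 : (⌊B⌋ : ℝ) + 1 ≤ ⌈A⌉ := by exact_mod_cast hlt
    have h2 := htriv A B
    rw [abs_of_nonneg (by linarith)] at h2
    rw [Finset.Icc_eq_empty (by omega), Finset.sum_empty, zero_sub, norm_neg]
    linarith [pi_pos]
  obtain ⟨N, hN⟩ := Int.le.dest hle
  have hNr : (⌈A⌉ : ℝ) + N = ⌊B⌋ := by exact_mod_cast hN
  have hN0 : (0 : ℝ) ≤ N := by positivity
  have hmono : MonotoneOn g' (Icc A B) := by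
    refine monotoneOn_of_deriv_nonneg (convex_Icc _ _)
      (fun x hx => (hg' x hx).continuousAt.continuousWithinAt)
      (fun x hx => (hg' x (interior_subset hx)).differentiableAt.differentiableWithinAt)
      (fun x hx => ?_)
    rw [(hg' x (interior_subset hx)).deriv]
    exact hconv x (interior_subset hx)
  have hsub : Icc (⌈A⌉ : ℝ) (⌈A⌉ + N) ⊆ Icc A B := Icc_subset_Icc hA (by linarith)
  have hmain := norm_sum_e_sub_integral_le (fun x hx => hg x (hsub hx)) (hmono.mono hsub)
    (fun x hx => (hbd x (hsub hx)).1) (fun x hx => (hbd x (hsub hx)).2)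
  have hsum : ∑ n ∈ Finset.Icc ⌈A⌉ ⌊B⌋, e (g n) =
      (∑ n ∈ Finset.range N, e (g (⌈A⌉ + n))) + e (g ⌊B⌋) := by
    rw [← hNr, ← Finset.sum_range_succ (fun n : ℕ => e (g (⌈A⌉ + n)))]
    symm
    refine Finset.sum_bij (fun n _ => ⌈A⌉ + n) ?_ ?_ ?_ ?_
    · intro n hn; simp at hn ⊢; omega
    · intro m _ n _ h; simpa using h
    · intro n hn
      rw [Finset.mem_Icc] at hn
      exact ⟨(n - ⌈A⌉).toNat, by simp; omega, by simp; omega⟩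
    · intro n _; simp
  have hcont : ContinuousOn (fun x => e (g x)) (Icc A B) :=
    continuous_e.comp_continuousOn fun x hx => (hg x hx).continuousAt.continuousWithinAt
  have hii {x y : ℝ} (hx : x ∈ Icc A B) (hy : y ∈ Icc A B) :
      IntervalIntegrable (fun x => e (g x)) MeasureTheory.volume x y :=
    (hcont.mono (uIcc_subset_Icc hx hy)).intervalIntegrable
  have hAm : A ∈ Icc A B := left_mem_Icc.2 hAB
  have hBm : B ∈ Icc A B := right_mem_Icc.2 hAB
  have hcm : (⌈A⌉ : ℝ) ∈ Icc A B := ⟨hA, by linarith⟩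
  have hfm : (⌊B⌋ : ℝ) ∈ Icc A B := ⟨by linarith, hB⟩
  have hsplit : ∫ x in A..B, e (g x) = (∫ x in A..⌈A⌉, e (g x))
      + (∫ x in (⌈A⌉ : ℝ)..⌊B⌋, e (g x)) + ∫ x in (⌊B⌋ : ℝ)..B, e (g x) := by
    rw [intervalIntegral.integral_add_adjacent_intervals (hii hAm hcm) (hii hcm hfm),
      intervalIntegral.integral_add_adjacent_intervals (hii hAm hfm) (hii hfm hBm)]
  have hl := htriv A ⌈A⌉
  have hr := htriv ⌊B⌋ B
  rw [abs_of_nonneg (by linarith)] at hl hr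
  rw [hNr] at hmain
  have heq : (∑ n ∈ Finset.Icc ⌈A⌉ ⌊B⌋, e (g n)) - ∫ x in A..B, e (g x) =
      (∑ n ∈ Finset.range N, e (g (⌈A⌉ + n)) - ∫ x in (⌈A⌉ : ℝ)..⌊B⌋, e (g x))
        + e (g ⌊B⌋) - (∫ x in A..⌈A⌉, e (g x)) - ∫ x in (⌊B⌋ : ℝ)..B, e (g x) := by
    rw [hsum, hsplit]; ring
  rw [heq]
  linarith [norm_sub_le_of_le
    (norm_sub_le_of_le (norm_add_le_of_le hmain (norm_e (g ⌊B⌋)).le) hl) hr]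
end
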